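/- Let T be a finite tree (a connected acyclic simple graph) on n vertices that is not isomorphic to any path graph. Then n ≤ 3·res(T) − 5. -/

import Mathlib

open SimpleGraph

/-- A set `S` of vertices is a resolving set of `G` if every pair of distinct vertices
`x, y` is resolved by some vertex `u ∈ S`, i.e. `d(u,x) ≠ d(u,y)`. -/
def IsResolvingSet {V : Type*} (G : SimpleGraph V) (S : Set V) : Prop :=
  ∀ x y : V, x ≠ y → ∃ u ∈ S, G.dist u x ≠ G.dist u y

/-- The resolving number of `G`: the minimum `k` such that every `k`-element subset of the
vertex set is a resolving set of `G`. -/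
noncomputable def resolvingNumber {V : Type*} [Fintype V] (G : SimpleGraph V) : ℕ :=
  sInf {k | ∀ S : Finset V, S.card = k → IsResolvingSet G ↑S}

namespace SimpleGraph

variable {V : Type*} {G : SimpleGraph V}

lemma Connected.exists_adj_dist_add_one_eq (hG : G.Connected) {u v : V} (huv : v ≠ u) :
    ∃ w, G.Adj v w ∧ G.dist u w + 1 = G.dist u v := by
  obtain ⟨p, hp⟩ := hG.exists_walk_length_eq_dist v u
  cases p with
  | nil => exact absurd rfl huv
  | @cons _ w _ h q =>
    refine ⟨w, h, ?_⟩
    have hq := dist_le q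
    have hd := h.diff_dist_adj (u := u)
    rw [Walk.length_cons] at hp
    rw [dist_comm] at hp hq
    grind [dist_comm]

/-- In an acyclic connected graph, at most one neighbor of `v` is closer to `u` than `v` is. -/
lemma IsTree.eq_of_adj_of_dist_add_one_eq (hG : G.IsTree) {u v a b : V}
    (ha : G.Adj v a) (hb : G.Adj v b) (hda : G.dist u a + 1 = G.dist u v)
    (hdb : G.dist u b + 1 = G.dist u v) : a = b := by
  obtain ⟨p, hp⟩ := hG.connected.exists_walk_length_eq_dist a u
  obtain ⟨q, hq⟩ := hG.connected.exists_walk_length_eq_dist b u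
  have hp' : (Walk.cons ha p).IsPath := Walk.isPath_of_length_eq_dist _ (by
    rw [Walk.length_cons, hp, dist_comm, hda, dist_comm])
  have hq' : (Walk.cons hb q).IsPath := Walk.isPath_of_length_eq_dist _ (by
    rw [Walk.length_cons, hq, dist_comm, hdb, dist_comm])
  have h := congrArg Walk.snd ((hG.existsUnique_path v u).unique hp' hq')
  simpa using h

/-- A finite connected graph in which the distances to some vertex are pairwise distinct is
a path. -/
lemma Connected.nonempty_iso_pathGraph_of_injective_dist [Fintype V] (hG : G.Connected) (u : V)
    (hinj : Function.Injective (G.dist u)) :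
    Nonempty (G ≃g pathGraph (Fintype.card V)) := by
  have hbelow (k : ℕ) (v : V) (hk : k ≤ G.dist u v) : ∃ w, G.dist u w = k := by
    induction hk using Nat.decreasingInduction with
    | self => exact ⟨v, rfl⟩
    | of_succ k _ ih =>
      obtain ⟨w, hw⟩ := ih
      obtain ⟨x, -, hx⟩ := hG.exists_adj_dist_add_one_eq (u := u) (v := w) (by
        rintro rfl
        simp at hw)
      exact ⟨x, by omega⟩
  have hlt (v : V) : G.dist u v < Fintype.card V := by
    have hsub : Finset.range (G.dist u v + 1) ⊆ Finset.univ.image (G.dist u) := by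
      intro k hk
      obtain ⟨w, hw⟩ := hbelow k v (by simpa [Nat.lt_succ_iff] using hk)
      exact Finset.mem_image.2 ⟨w, Finset.mem_univ w, hw⟩
    have := (Finset.card_le_card hsub).trans Finset.card_image_le
    simpa [Nat.succ_le_iff] using this
  let f : V → Fin (Fintype.card V) := fun v ↦ ⟨G.dist u v, hlt v⟩
  have hf : Function.Bijective f := (Fintype.bijective_iff_injective_and_card f).2
    ⟨fun x y h ↦ hinj (congrArg Fin.val h), by simp⟩
  have hadj (x y : V) (h : G.dist u x + 1 = G.dist u y) : G.Adj x y := by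
    obtain ⟨w, hw, hd⟩ := hG.exists_adj_dist_add_one_eq (u := u) (v := y) (by
      rintro rfl
      simp at h)
    have hwx : w = x := hinj (by omega)
    exact hwx ▸ hw.symm
  refine ⟨⟨Equiv.ofBijective f hf, ?_⟩⟩
  intro x y
  simp only [Equiv.ofBijective_apply, pathGraph_adj, f]
  constructor
  · rintro (h | h)
    exacts [hadj x y h, (hadj y x h).symm]
  · intro h
    have hne := hinj.ne h.ne
    have hd := h.diff_dist_adj (u := u)
    omega

lemma IsTree.exists_subsingleton_neighborSet [Finite V] (hG : G.IsTree) :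
    ∃ u, (G.neighborSet u).Subsingleton := by
  classical
  have := Fintype.ofFinite V
  have := hG.connected.nonempty
  obtain h | h := subsingleton_or_nontrivial V
  · exact ⟨Classical.arbitrary V, Set.subsingleton_of_subsingleton⟩
  · obtain ⟨u, hu⟩ := hG.exists_vert_degree_one_of_nontrivial
    obtain ⟨w, -, hw⟩ := degree_eq_one_iff_existsUnique_adj.1 hu
    exact ⟨u, fun x hx y hy ↦ (hw x hx).trans (hw y hy).symm⟩

/-- A finite tree that is not a path has a vertex with three distinct neighbors. -/
lemma IsTree.exists_three_adj_of_not_path [Fintype V] (hG : G.IsTree)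
    (hpath : ¬ ∃ n : ℕ, Nonempty (G ≃g pathGraph n)) :
    ∃ v a b c, G.Adj v a ∧ G.Adj v b ∧ G.Adj v c ∧ a ≠ b ∧ a ≠ c ∧ b ≠ c := by
  by_contra! hdeg
  obtain ⟨u, hu⟩ := hG.exists_subsingleton_neighborSet
  refine hpath ⟨_, hG.connected.nonempty_iso_pathGraph_of_injective_dist u ?_⟩
  suffices h : ∀ k x y, G.dist u x = k → G.dist u y = k → x = y from
    fun x y hxy ↦ h _ x y rfl hxy.symm
  intro k
  induction k with
  | zero =>
    intro x y hx hy
    rw [hG.connected.dist_eq_zero_iff] at hx hy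
    exact hx.symm.trans hy
  | succ k ih =>
    intro x y hx hy
    obtain ⟨w, hxw, hw⟩ := hG.connected.exists_adj_dist_add_one_eq (u := u) (v := x) (by
      rintro rfl
      simp at hx)
    obtain ⟨w', hyw, hw'⟩ := hG.connected.exists_adj_dist_add_one_eq (u := u) (v := y) (by
      rintro rfl
      simp at hy)
    obtain rfl : w = w' := ih w w' (by omega) (by omega)
    by_cases hwu : w = u
    · subst hwu
      exact hu hxw.symm hyw.symm
    · obtain ⟨z, hwz, hz⟩ := hG.connected.exists_adj_dist_add_one_eq hwu
      by_contra hxy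
      have hyz := hdeg w x y z hxw.symm hyw.symm hwz hxy (by
        rintro rfl
        omega)
      subst hyz
      omega

end SimpleGraph

lemma card_lt_resolvingNumber {V : Type*} [Fintype V] {G : SimpleGraph V} {S : Finset V}
    (hS : ¬ IsResolvingSet G ↑S) : S.card < resolvingNumber G := by
  have hne : {k | ∀ S : Finset V, S.card = k → IsResolvingSet G ↑S}.Nonempty :=
    ⟨Fintype.card V + 1, fun S hS ↦ by
      have := S.card_le_univ
      omega⟩
  have hmem := Nat.sInf_mem hne
  by_contra! hle
  obtain ⟨R, hRS, hR⟩ := Finset.exists_subset_card_eq hle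
  refine hS fun x y hxy ↦ ?_
  obtain ⟨u, hu, h⟩ := hmem R hR x y hxy
  exact ⟨u, hRS hu, h⟩

lemma card_filter_dist_eq_lt_resolvingNumber {V : Type*} [Fintype V] {G : SimpleGraph V}
    {x y : V} (hxy : x ≠ y) :
    (Finset.univ.filter fun u ↦ G.dist u x = G.dist u y).card < resolvingNumber G := by
  refine card_lt_resolvingNumber fun h ↦ ?_
  obtain ⟨u, hu, hne⟩ := h x y hxy
  exact hne (by simpa using hu)

/-- For a tree that is not a path, n ≤ 3·res(T) − 5. -/
theorem stmt16 {V : Type*} [Fintype V] (T : SimpleGraph V) (hT : T.IsTree)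
    (hpath : ¬ ∃ n : ℕ, Nonempty (T ≃g pathGraph n)) :
    Fintype.card V ≤ 3 * resolvingNumber T - 5 := by
  classical
  obtain ⟨v, a, b, c, ha, hb, hc, hab, hac, hbc⟩ := hT.exists_three_adj_of_not_path hpath
  have hA := card_filter_dist_eq_lt_resolvingNumber (G := T) hab
  have hB := card_filter_dist_eq_lt_resolvingNumber (G := T) hac
  have hC := card_filter_dist_eq_lt_resolvingNumber (G := T) hbc
  have hsum : ∑ u : V, (1 + if u = v then 2 else 0) ≤ ∑ u : V,
      ((if T.dist u a = T.dist u b then 1 else 0) + (if T.dist u a = T.dist u c then 1 else 0) +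
        if T.dist u b = T.dist u c then 1 else 0) := by
    refine Finset.sum_le_sum fun u _ ↦ ?_
    by_cases huv : u = v
    · subst huv
      simp [dist_eq_one_iff_adj.2 ha, dist_eq_one_iff_adj.2 hb, dist_eq_one_iff_adj.2 hc]
    · have h₁ := hT.dist_eq_dist_add_one_of_adj u ha
      have h₂ := hT.dist_eq_dist_add_one_of_adj u hb
      have h₃ := hT.dist_eq_dist_add_one_of_adj u hc
      have h₄ := fun h h' ↦ hab (hT.eq_of_adj_of_dist_add_one_eq (u := u) ha hb h h')
      have h₅ := fun h h' ↦ hac (hT.eq_of_adj_of_dist_add_one_eq (u := u) ha hc h h')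
      have h₆ := fun h h' ↦ hbc (hT.eq_of_adj_of_dist_add_one_eq (u := u) hb hc h h')
      rw [if_neg huv]
      split_ifs <;> omega
  simp only [Finset.sum_add_distrib, ← Finset.card_filter, Finset.sum_ite_eq', Finset.mem_univ,
    if_true, Finset.sum_const, Finset.card_univ, smul_eq_mul, mul_one] at hsum
  omega
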